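/- arXiv:1702.02308 — 3 statements merged into one kernel-verified Lean document; each statement's English description precedes it below -/
import Mathlib

section
/- Let 𝒯=(V,ℰ) be a leafless, locally finite rooted directed tree of finite branching index, let q be a positive integer, and let S_{λ,q} be the Dirichlet shift on ℓ²(V). Let S_{w,q} denote the classical Dirichlet shift on ℓ²(ℕ), the bounded operator with S_{w,q} e_n = √((n+q)/(n+1)) e_{n+1} for n ∈ ℕ. Then there exist a positive integer l and a unitary operator U : ℓ²(V) → ⊕_{j=1}^{l} ℓ²(ℕ) intertwining S_{λ,q} with the orthogonal direct sum of l copies of S_{w,q} if and only if either q = 1 or 𝒯 has no branching vertex (equivalently, 𝒯 is isomorphic to ℕ). -/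
open scoped ENNReal InnerProductSpace
open ContinuousLinearMap

noncomputable section

/-- A (countably infinite) rooted directed tree. -/
structure DirTree (V : Type) where
  edge : V → V → Prop
  not_self : ∀ v, ¬ edge v v
  no_circuit : ∀ v, ¬ Relation.TransGen edge v v
  connected : ∀ u v : V, Relation.ReflTransGen (fun a b => edge a b ∨ edge b a) u v
  uniq_parent : ∀ {u w v : V}, edge u v → edge w v → u = w
  root : V
  root_no_parent : ∀ u, ¬ edge u root
  root_uniq : ∀ v, (∀ u, ¬ edge u v) → v = root

namespace DirTree

variable {V : Type} (T : DirTree V)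

/-- The set of children of a vertex. -/
def chi (v : V) : Set V := {u | T.edge v u}

/-- Leafless: every vertex has a child. -/
def Leafless : Prop := ∀ v : V, ∃ u, T.edge v u

/-- Locally finite: every vertex has finitely many children. -/
def LocFin : Prop := ∀ v : V, (T.chi v).Finite

/-- The finset of children of a vertex (locally finite case). -/
def chiFin (hT : T.LocFin) (v : V) : Finset V := (hT v).toFinset

/-- Iterated child sets `Chi^⟨n⟩(W)`. -/
def chiIter (T : DirTree V) : ℕ → Set V → Set V
  | 0, W => W
  | n + 1, W => {u | ∃ v ∈ chiIter T n W, T.edge v u}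

/-- The depth of a vertex: the unique `n` with `v ∈ Chi^⟨n⟩(root)`. -/
def depth (v : V) : ℕ := sInf {n | v ∈ T.chiIter n {T.root}}

/-- The parent map (junk value at the root). -/
def par (v : V) : V :=
  letI := Classical.propDecidable (∃ u, T.edge u v)
  if h : ∃ u, T.edge u v then h.choose else v

end DirTree

/-- `ℓ²(V)`. -/
abbrev l2 (V : Type) := lp (fun _ : V => ℂ) 2

/-- The standard orthonormal basis vector `e_v` of `ℓ²(V)`. -/
def evec {V : Type} (v : V) : l2 V :=
  letI := Classical.decEq V
  lp.single 2 v 1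

/-- The Pochhammer symbol `(x)_k = x (x+1) ⋯ (x+k-1)`. -/
def poch (x : ℝ) (k : ℕ) : ℝ := ∏ i ∈ Finset.range k, (x + i)

namespace DirTree

variable {V : Type} (T : DirTree V)

/-- The weight `λ_{u,q}` (for any child `u` of `v`). -/
def wt (hT : T.LocFin) (q : ℝ) (v : V) : ℝ :=
  Real.sqrt (((T.depth v : ℝ) + q) / ((T.depth v : ℝ) + 1)) /
    Real.sqrt ((T.chiFin hT v).card)

/-- `S` is the Dirichlet shift with parameter `q` on `ℓ²(V)`:
`S e_v = ∑_{u ∈ Chi(v)} λ_{u,q} e_u`. -/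
def IsDirichletShift (hT : T.LocFin) (q : ℝ) (S : l2 V →L[ℂ] l2 V) : Prop :=
  ∀ v : V, S (evec v) = ∑ u ∈ T.chiFin hT v, ((T.wt hT q v : ℝ) : ℂ) • evec u

end DirTree

/-- The Cauchy dual `S (S*S)⁻¹` of a left-invertible operator. -/
def cauchyDual {V : Type} (S : l2 V →L[ℂ] l2 V) : l2 V →L[ℂ] l2 V :=
  S * Ring.inverse (ContinuousLinearMap.adjoint S * S)

section l2

variable {V : Type}

theorem evec_apply_self (v : V) : (evec v : l2 V) v = 1 := by
  simp [evec, lp.single_apply]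

theorem evec_apply_ne {v u : V} (h : u ≠ v) : (evec v : l2 V) u = 0 := by
  classical
  simp [evec, lp.single_apply, h]

theorem inner_evec (v : V) (f : l2 V) : ⟪evec v, f⟫_ℂ = f v := by
  simp [evec, lp.inner_single_left]

theorem l2_ext {f g : l2 V} (h : ∀ v, f v = g v) : f = g :=
  lp.ext (funext h)

theorem evec_ne_zero (v : V) : (evec v : l2 V) ≠ 0 := fun h => by
  have := evec_apply_self v
  rw [h] at this
  simp at this

theorem orthonormal_evec : Orthonormal ℂ (evec : V → l2 V) := by
  classical
  rw [orthonormal_iff_ite]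
  intro i j
  rw [inner_evec]
  split_ifs with h
  · rw [h, evec_apply_self]
  · exact evec_apply_ne h

end l2

section DirectSum

/-- An orthonormal family orthogonal only to `0`, as a Hilbert basis. -/
def hilbertBasisOfInnerEqZero {ι E : Type*} [NormedAddCommGroup E] [InnerProductSpace ℂ E]
    [CompleteSpace E] {b : ι → E} (hb : Orthonormal ℂ b)
    (h : ∀ x, (∀ i, ⟪b i, x⟫_ℂ = 0) → x = 0) : HilbertBasis ι ℂ E :=
  HilbertBasis.mkOfOrthogonalEqBot hb <| by
    rw [Submodule.eq_bot_iff]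
    exact fun x hx => h x fun i =>
      (Submodule.mem_orthogonal _ _).1 hx _ (Submodule.subset_span ⟨i, rfl⟩)

theorem coe_hilbertBasisOfInnerEqZero {ι E : Type*} [NormedAddCommGroup E]
    [InnerProductSpace ℂ E] [CompleteSpace E] {b : ι → E} (hb : Orthonormal ℂ b)
    (h : ∀ x, (∀ i, ⟪b i, x⟫_ℂ = 0) → x = 0) :
    ⇑(hilbertBasisOfInnerEqZero hb h) = b :=
  HilbertBasis.coe_mkOfOrthogonalEqBot _ _

theorem inner_piLp_single {l : ℕ} (j : Fin l) (y : l2 ℕ) (x : PiLp 2 fun _ : Fin l => l2 ℕ) :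
    ⟪PiLp.single 2 j y, x⟫_ℂ = ⟪y, x j⟫_ℂ := by
  rw [PiLp.inner_apply, Finset.sum_eq_single j]
  · simp
  · intro i _ hi
    simp [hi]
  · simp

/-- The standard Hilbert basis of a finite direct sum of copies of `ℓ²(ℕ)`. -/
def directSumBasis (l : ℕ) :
    HilbertBasis (Fin l × ℕ) ℂ (PiLp 2 fun _ : Fin l => l2 ℕ) :=
  hilbertBasisOfInnerEqZero (b := fun p => PiLp.single 2 p.1 (evec p.2))
    (by
      rw [orthonormal_iff_ite]
      rintro ⟨i, n⟩ ⟨j, m⟩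
      rw [inner_piLp_single]
      by_cases hij : i = j
      · subst hij
        simp only [PiLp.single_eq_same, orthonormal_iff_ite.1 orthonormal_evec, Prod.mk.injEq,
          true_and]
      · simp [hij])
    (fun x hx => by
      ext j : 1
      refine l2_ext fun n => ?_
      rw [← inner_evec, ← inner_piLp_single]
      simpa using hx (j, n))

theorem directSumBasis_apply {l : ℕ} (p : Fin l × ℕ) :
    directSumBasis l p = PiLp.single 2 p.1 (evec p.2) := by
  simp [directSumBasis, coe_hilbertBasisOfInnerEqZero]

/-- An operator acting on a Hilbert basis indexed by `Fin l × ℕ` as a weighted shift in the second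
index is unitarily equivalent to the direct sum of `l` copies of that weighted shift. -/
theorem exists_unitary_of_hilbertBasis {E : Type*} [NormedAddCommGroup E]
    [InnerProductSpace ℂ E] [CompleteSpace E] {l : ℕ} (b : HilbertBasis (Fin l × ℕ) ℂ E)
    {S : E →L[ℂ] E} {Sw : l2 ℕ →L[ℂ] l2 ℕ} {w : ℕ → ℂ}
    (hSw : ∀ n, Sw (evec n) = w n • evec (n + 1))
    (hS : ∀ j n, S (b (j, n)) = w n • b (j, n + 1)) :
    ∃ U : E ≃ₗᵢ[ℂ] PiLp 2 (fun _ : Fin l => l2 ℕ), ∀ f, U (S f) = fun j => Sw (U f j) := by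
  let U : E ≃ₗᵢ[ℂ] PiLp 2 (fun _ : Fin l => l2 ℕ) := b.repr.trans (directSumBasis l).repr.symm
  have hUb : ∀ p, U (b p) = PiLp.single 2 p.1 (evec p.2) := fun p => by
    rw [← directSumBasis_apply, LinearIsometryEquiv.trans_apply, b.repr_self,
      HilbertBasis.repr_symm_single]
  refine ⟨U, fun f => funext fun k => ?_⟩
  let proj : (PiLp 2 fun _ : Fin l => l2 ℕ) →L[ℂ] l2 ℕ := PiLp.proj 2 _ k
  let U' : E →L[ℂ] PiLp 2 (fun _ : Fin l => l2 ℕ) := U.toContinuousLinearEquiv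
  have key : proj ∘L U' ∘L S = Sw ∘L proj ∘L U' := by
    refine ContinuousLinearMap.ext_on
      (Submodule.dense_iff_topologicalClosure_eq_top.2 b.dense_span) ?_
    rintro _ ⟨⟨j, n⟩, rfl⟩
    change (U (S (b (j, n)))) k = Sw ((U (b (j, n))) k)
    rw [hS, map_smul, hUb, hUb]
    by_cases hk : k = j
    · subst hk
      simp [hSw]
    · simp [hk]
  exact DFunLike.congr_fun key f

end DirectSum

namespace DirTree

variable {V : Type} {T : DirTree V}

section Depth

theorem chiIter_root_injective {m n : ℕ} {v : V} (hm : v ∈ T.chiIter m {T.root})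
    (hn : v ∈ T.chiIter n {T.root}) : m = n := by
  induction m generalizing n v with
  | zero =>
    cases n with
    | zero => rfl
    | succ n =>
      obtain ⟨u, -, hu⟩ := hn
      rw [show v = T.root from hm] at hu
      exact (T.root_no_parent u hu).elim
  | succ m ih =>
    obtain ⟨u, hu, huv⟩ := hm
    cases n with
    | zero =>
      rw [show v = T.root from hn] at huv
      exact (T.root_no_parent u huv).elim
    | succ n =>
      obtain ⟨u', hu', huv'⟩ := hn
      rw [T.uniq_parent huv' huv] at hu'
      rw [ih hu hu']

variable (T) in
theorem exists_mem_chiIter (v : V) : ∃ n, v ∈ T.chiIter n {T.root} := by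
  induction T.connected T.root v with
  | refl => exact ⟨0, rfl⟩
  | @tail a b _ hab ih =>
    obtain ⟨n, hn⟩ := ih
    rcases hab with hab | hba
    · exact ⟨n + 1, a, hn, hab⟩
    · cases n with
      | zero =>
        rw [show a = T.root from hn] at hba
        exact (T.root_no_parent b hba).elim
      | succ n =>
        obtain ⟨u, hu, hua⟩ := hn
        exact ⟨n, T.uniq_parent hua hba ▸ hu⟩

variable (T) in
theorem mem_chiIter_depth (v : V) : v ∈ T.chiIter (T.depth v) {T.root} :=
  Nat.sInf_mem (s := {n | v ∈ T.chiIter n {T.root}}) (T.exists_mem_chiIter v)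

theorem depth_eq {v : V} {n : ℕ} (h : v ∈ T.chiIter n {T.root}) : T.depth v = n :=
  chiIter_root_injective (T.mem_chiIter_depth v) h

theorem depth_of_edge {v u : V} (h : T.edge v u) : T.depth u = T.depth v + 1 :=
  depth_eq ⟨v, T.mem_chiIter_depth v, h⟩

/-- Induction along the edges, starting from the root. -/
theorem edge_induction {p : V → Prop} (root : p T.root) (step : ∀ v u, T.edge v u → p v → p u)
    (v : V) : p v := by
  have h : ∀ n v, v ∈ T.chiIter n {T.root} → p v := by
    intro n
    induction n with
    | zero => exact fun v hv => (show v = T.root from hv) ▸ root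
    | succ n ih => exact fun v ⟨u, hu, huv⟩ => step u v huv (ih u hu)
  exact h _ v (T.mem_chiIter_depth v)

theorem finite_chiIter (hT : T.LocFin) (n : ℕ) : (T.chiIter n {T.root}).Finite := by
  induction n with
  | zero => exact Set.finite_singleton _
  | succ n ih =>
    refine (ih.biUnion fun v _ => hT v).subset ?_
    rintro u ⟨v, hv, hvu⟩
    exact Set.mem_biUnion hv hvu

theorem finite_depth_le (hT : T.LocFin) (n : ℕ) : {v | T.depth v ≤ n}.Finite := by
  refine ((Set.finite_Iic n).biUnion fun k _ => T.finite_chiIter hT k).subset ?_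
  intro v hv
  exact Set.mem_biUnion (show T.depth v ∈ Set.Iic n from hv) (T.mem_chiIter_depth v)

end Depth

section Shift

variable {hT : T.LocFin} {q : ℝ} {S : l2 V →L[ℂ] l2 V}

theorem mem_chiFin {v u : V} : u ∈ T.chiFin hT v ↔ T.edge v u := by
  simp [chiFin, chi]

theorem card_chiFin_pos (hL : T.Leafless) (v : V) : 0 < (T.chiFin hT v).card := by
  obtain ⟨u, hu⟩ := hL v
  exact Finset.card_pos.2 ⟨u, mem_chiFin.2 hu⟩

theorem wt_pos (hq : 0 < q) (hL : T.Leafless) (v : V) : 0 < T.wt hT q v := by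
  have := card_chiFin_pos (hT := hT) hL v
  unfold wt
  positivity

theorem wt_sq_mul_card (hq : 0 < q) (hL : T.Leafless) (v : V) :
    T.wt hT q v * T.wt hT q v * (T.chiFin hT v).card
      = ((T.depth v : ℝ) + q) / ((T.depth v : ℝ) + 1) := by
  have h : (0 : ℝ) < (T.chiFin hT v).card := by exact_mod_cast card_chiFin_pos hL v
  rw [← pow_two, wt, div_pow, Real.sq_sqrt (by positivity), Real.sq_sqrt h.le,
    div_mul_cancel₀ _ h.ne']

namespace IsDirichletShift

theorem adjoint_apply (hS : T.IsDirichletShift hT q S) (f : l2 V) (v : V) :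
    (adjoint S f) v = (T.wt hT q v : ℂ) * ∑ u ∈ T.chiFin hT v, f u := by
  rw [← inner_evec, adjoint_inner_right, hS v, sum_inner, Finset.mul_sum]
  refine Finset.sum_congr rfl fun u _ => ?_
  rw [inner_smul_left, inner_evec, Complex.conj_ofReal]

theorem adjoint_evec_root (hS : T.IsDirichletShift hT q S) : adjoint S (evec T.root) = 0 := by
  refine l2_ext fun v => ?_
  rw [hS.adjoint_apply, Finset.sum_eq_zero, mul_zero]
  · rfl
  · intro u hu
    refine evec_apply_ne ?_
    rintro rfl
    exact T.root_no_parent v (mem_chiFin.1 hu)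

theorem adjoint_evec (hS : T.IsDirichletShift hT q S) {v u : V} (h : T.edge v u) :
    adjoint S (evec u) = (T.wt hT q v : ℂ) • evec v := by
  refine l2_ext fun x => ?_
  rw [hS.adjoint_apply, lp.coeFn_smul, Pi.smul_apply, smul_eq_mul]
  by_cases hx : x = v
  · subst hx
    rw [evec_apply_self, Finset.sum_eq_single u, evec_apply_self]
    · exact fun y _ hy => evec_apply_ne hy
    · exact fun hu => (hu (mem_chiFin.2 h)).elim
  · rw [evec_apply_ne hx, Finset.sum_eq_zero, mul_zero, mul_zero]
    intro y hy
    refine evec_apply_ne ?_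
    rintro rfl
    exact hx (T.uniq_parent (mem_chiFin.1 hy) h)

theorem apply_root (hS : T.IsDirichletShift hT q S) (f : l2 V) : (S f) T.root = 0 := by
  rw [← inner_evec, ← adjoint_inner_left, hS.adjoint_evec_root, inner_zero_left]

theorem apply_child (hS : T.IsDirichletShift hT q S) {v u : V} (h : T.edge v u) (f : l2 V) :
    (S f) u = (T.wt hT q v : ℂ) * f v := by
  rw [← inner_evec, ← adjoint_inner_left, hS.adjoint_evec h, inner_smul_left, inner_evec,
    Complex.conj_ofReal]

theorem adjoint_comp_self_apply (hS : T.IsDirichletShift hT q S) (hq : 0 < q) (hL : T.Leafless)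
    (f : l2 V) (v : V) :
    (adjoint S (S f)) v = ((((T.depth v : ℝ) + q) / ((T.depth v : ℝ) + 1) : ℝ) : ℂ) * f v := by
  rw [hS.adjoint_apply, Finset.sum_congr rfl fun u hu => hS.apply_child (mem_chiFin.1 hu) f,
    Finset.sum_const, nsmul_eq_mul, ← wt_sq_mul_card hq hL (hT := hT)]
  push_cast
  ring

theorem adjoint_comp_self_of_one (hS : T.IsDirichletShift hT q S) (hL : T.Leafless)
    (hq : q = 1) (f : l2 V) :
    adjoint S (S f) = f := by
  refine l2_ext fun v => ?_
  rw [hS.adjoint_comp_self_apply (by simp [hq]) hL, hq, div_self (by positivity)]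
  simp

theorem finiteDimensional_ker_adjoint (hS : T.IsDirichletShift hT q S) (hq : 0 < q)
    (hL : T.Leafless)
    (hb : ∃ N : ℕ, ∀ v : V, 2 ≤ (T.chiFin hT v).card → T.depth v ≤ N) :
    FiniteDimensional ℂ (LinearMap.ker (adjoint S).toLinearMap) := by
  obtain ⟨N, hN⟩ := hb
  have : Finite {v | T.depth v ≤ N + 1} := T.finite_depth_le hT (N + 1)
  let φ : LinearMap.ker (adjoint S).toLinearMap →ₗ[ℂ] ({v | T.depth v ≤ N + 1} → ℂ) :=
    { toFun := fun f v => (f : l2 V) v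
      map_add' := fun f g => rfl
      map_smul' := fun c f => rfl }
  refine FiniteDimensional.of_injective φ ((injective_iff_map_eq_zero φ).2 ?_)
  rintro ⟨f, hf⟩ hφ
  refine Subtype.ext (l2_ext fun v => ?_)
  induction v using T.edge_induction with
  | root => exact congrFun hφ ⟨T.root, by simp [depth_eq (T := T) (n := 0) (v := T.root) rfl]⟩
  | step w u hwu _ =>
    by_cases hw : T.depth w ≤ N
    · exact congrFun hφ ⟨u, by simpa [depth_of_edge hwu] using hw⟩
    · have hcard : (T.chiFin hT w).card ≤ 1 := by
        by_contra h
        exact hw (hN w (by omega))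
      have hu := mem_chiFin (hT := hT).2 hwu
      have h0 : (adjoint S f) w = 0 := by
        rw [show adjoint S f = 0 from hf]
        rfl
      rw [hS.adjoint_apply, Finset.sum_eq_single_of_mem u hu fun y hy hne =>
        (hne (Finset.card_le_one.1 hcard _ hy _ hu)).elim] at h0
      exact (mul_eq_zero.1 h0).resolve_left (Complex.ofReal_ne_zero.2 (wt_pos hq hL w).ne')

end IsDirichletShift

end Shift

end DirTree

section Wold

variable {E : Type*} [NormedAddCommGroup E] [InnerProductSpace ℂ E] [CompleteSpace E]
  {S : E →L[ℂ] E} {ι : Type*} {f : ι → E}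

theorem orthonormal_pow_apply (hS : ∀ x, adjoint S (S x) = x) (hf : Orthonormal ℂ f)
    (hker : ∀ i, adjoint S (f i) = 0) :
    Orthonormal ℂ fun p : ι × ℕ => (S ^ p.2) (f p.1) := by
  classical
  rw [orthonormal_iff_ite]
  rintro ⟨i, n⟩ ⟨j, m⟩
  simp only
  induction n generalizing m with
  | zero =>
    cases m with
    | zero => simpa using orthonormal_iff_ite.1 hf i j
    | succ m => simp [pow_succ', ← adjoint_inner_left, hker]
  | succ n ih =>
    cases m with
    | zero => simp [pow_succ', ← adjoint_inner_right, hker]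
    | succ m =>
      rw [pow_succ', pow_succ', mul_apply_eq_comp, mul_apply_eq_comp,
        ← adjoint_inner_right, hS, ih]
      simp

/-- A vector orthogonal to the kernel of the adjoint of an isometry lies in its range. -/
theorem apply_adjoint_of_orthogonal (hS : ∀ x, adjoint S (S x) = x) {x : E}
    (hx : ∀ y, adjoint S y = 0 → ⟪y, x⟫_ℂ = 0) : S (adjoint S x) = x := by
  have hker : adjoint S (x - S (adjoint S x)) = 0 := by rw [map_sub, hS, sub_self]
  have h : ⟪x - S (adjoint S x), x - S (adjoint S x)⟫_ℂ = 0 := by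
    rw [inner_sub_right, hx _ hker, ← adjoint_inner_left, hker, inner_zero_left, sub_zero]
  exact (sub_eq_zero.1 (inner_self_eq_zero.1 h)).symm

end Wold

namespace DirTree.IsDirichletShift

variable {V : Type} {T : DirTree V} {hT : T.LocFin} {q : ℝ} {S : l2 V →L[ℂ] l2 V}

/-- For `q = 1` the shift is a pure isometry of finite multiplicity, hence has a Wold basis. -/
theorem exists_wold_basis (hS : T.IsDirichletShift hT 1 S) (hL : T.Leafless)
    (hb : ∃ N : ℕ, ∀ v : V, 2 ≤ (T.chiFin hT v).card → T.depth v ≤ N) :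
    ∃ l : ℕ, 0 < l ∧ ∃ b : HilbertBasis (Fin l × ℕ) ℂ (l2 V),
      ∀ j n, S (b (j, n)) = b (j, n + 1) := by
  have hiso := hS.adjoint_comp_self_of_one hL rfl
  let E := LinearMap.ker (adjoint S).toLinearMap
  have : FiniteDimensional ℂ E := hS.finiteDimensional_ker_adjoint one_pos hL hb
  have hroot : (evec T.root : l2 V) ∈ E := hS.adjoint_evec_root
  have : Nontrivial E :=
    ⟨⟨_, hroot⟩, 0, fun h => evec_ne_zero T.root (congrArg Subtype.val h)⟩
  let e := stdOrthonormalBasis ℂ E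
  let f : Fin (Module.finrank ℂ E) → l2 V := fun j => e j
  have hf : Orthonormal ℂ f := e.orthonormal.comp_linearIsometry E.subtypeₗᵢ
  have hker : ∀ j, adjoint S (f j) = 0 := fun j => (e j).2
  have hort : ∀ x : l2 V, (∀ j, ⟪f j, x⟫_ℂ = 0) → ∀ y, adjoint S y = 0 → ⟪y, x⟫_ℂ = 0 := by
    intro x hx y hy
    have hsum := congrArg Subtype.val (e.sum_repr ⟨y, hy⟩)
    rw [← show _ = y from hsum, Submodule.coe_sum, sum_inner]
    refine Finset.sum_eq_zero fun j _ => ?_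
    rw [Submodule.coe_smul, inner_smul_left]
    exact mul_eq_zero_of_right _ (hx j)
  have hcomplete : ∀ x : l2 V, (∀ p : Fin (Module.finrank ℂ E) × ℕ,
      ⟪(S ^ p.2) (f p.1), x⟫_ℂ = 0) → x = 0 := by
    intro x hx
    refine l2_ext fun v => ?_
    induction v using T.edge_induction generalizing x with
    | root =>
      rw [← apply_adjoint_of_orthogonal hiso (hort x fun j => by simpa using hx (j, 0)),
        hS.apply_root]
      rfl
    | step v u hvu ih =>
      rw [← apply_adjoint_of_orthogonal hiso (hort x fun j => by simpa using hx (j, 0)),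
        hS.apply_child hvu, ih (adjoint S x)]
      · simp
      · rintro ⟨j, n⟩
        rw [adjoint_inner_right]
        simpa [pow_succ'] using hx (j, n + 1)
  refine ⟨_, Module.finrank_pos, hilbertBasisOfInnerEqZero
    (orthonormal_pow_apply hiso hf hker) hcomplete, fun j n => ?_⟩
  simp only [coe_hilbertBasisOfInnerEqZero, pow_succ', mul_apply_eq_comp]

/-- On a tree without branching vertices the vertices, ordered by depth, form a basis on which the
shift acts as the classical one. -/
theorem exists_basis_of_card_le_one (hS : T.IsDirichletShift hT q S) (hL : T.Leafless)
    (hcard : ∀ v : V, (T.chiFin hT v).card ≤ 1) :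
    ∃ b : HilbertBasis (Fin 1 × ℕ) ℂ (l2 V), ∀ j n, S (b (j, n)) =
      ((Real.sqrt (((n : ℝ) + q) / ((n : ℝ) + 1)) : ℝ) : ℂ) • b (j, n + 1) := by
  choose child hchild using hL
  let path : ℕ → V := fun n => child^[n] T.root
  have hsucc : ∀ n, path (n + 1) = child (path n) := fun n =>
    Function.iterate_succ_apply' child n T.root
  have hedge : ∀ n, T.edge (path n) (path (n + 1)) := fun n => hsucc n ▸ hchild (path n)
  have hdepth : ∀ n, T.depth (path n) = n := by
    intro n
    induction n with
    | zero => exact depth_eq rfl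
    | succ n ih => rw [depth_of_edge (hedge n), ih]
  have hchi : ∀ n, T.chiFin hT (path n) = {path (n + 1)} := fun n =>
    Finset.eq_singleton_iff_unique_mem.2 ⟨mem_chiFin.2 (hedge n), fun y hy =>
      Finset.card_le_one.1 (hcard _) _ hy _ (mem_chiFin.2 (hedge n))⟩
  have hsurj : ∀ v, ∃ n, path n = v := by
    intro v
    induction v using T.edge_induction with
    | root => exact ⟨0, rfl⟩
    | step v u hvu ih =>
      obtain ⟨n, rfl⟩ := ih
      have hu := mem_chiFin (hT := hT).2 hvu
      rw [hchi, Finset.mem_singleton] at hu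
      exact ⟨n + 1, hu.symm⟩
  have hinj : Function.Injective fun p : Fin 1 × ℕ => path p.2 := fun p p' h =>
    Prod.ext (Subsingleton.elim _ _) (by simpa [hdepth] using congrArg T.depth h)
  refine ⟨hilbertBasisOfInnerEqZero (orthonormal_evec.comp _ hinj) ?_, fun j n => ?_⟩
  · intro x hx
    refine l2_ext fun v => ?_
    obtain ⟨n, rfl⟩ := hsurj v
    rw [← inner_evec]
    exact hx (0, n)
  · simp [coe_hilbertBasisOfInnerEqZero, hS (path n), hchi, wt, hdepth]

/-- The difference of two siblings is annihilated by the adjoint of the shift. -/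
theorem adjoint_sub_siblings (hS : T.IsDirichletShift hT q S) {v u u' : V} (hu : T.edge v u)
    (hu' : T.edge v u') : adjoint S (evec u - evec u') = 0 := by
  rw [map_sub, hS.adjoint_evec hu, hS.adjoint_evec hu', sub_self]

theorem norm_sq_sub_siblings (hS : T.IsDirichletShift hT q S) (hq : 0 < q) (hL : T.Leafless)
    {v u u' : V} (hu : T.edge v u) (hu' : T.edge v u') :
    ‖S (evec u - evec u')‖ ^ 2 =
      ((T.depth v : ℝ) + 1 + q) / ((T.depth v : ℝ) + 2) * ‖(evec u - evec u' : l2 V)‖ ^ 2 := by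
  have heq : adjoint S (S (evec u - evec u')) =
      ((((T.depth v : ℝ) + 1 + q) / ((T.depth v : ℝ) + 2) : ℝ) : ℂ) •
        (evec u - evec u' : l2 V) := by
    refine l2_ext fun x => ?_
    rw [hS.adjoint_comp_self_apply hq hL, lp.coeFn_smul, Pi.smul_apply, smul_eq_mul]
    by_cases hx : T.edge v x
    · rw [depth_of_edge hx]
      push_cast
      ring
    · have hxu : x ≠ u := fun h => hx (h ▸ hu)
      have hxu' : x ≠ u' := fun h => hx (h ▸ hu')
      simp [evec_apply_ne hxu, evec_apply_ne hxu']
  have h := congrArg RCLike.re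
    (adjoint_inner_right S (evec u - evec u') (S (evec u - evec u')))
  rw [heq, inner_smul_right, inner_self_eq_norm_sq_to_K, inner_self_eq_norm_sq_to_K] at h
  simp only [RCLike.ofReal_eq_complex_ofReal, ← Complex.ofReal_pow, ← Complex.ofReal_mul,
    RCLike.re_eq_complex_re, Complex.ofReal_re] at h
  exact h.symm

end DirTree.IsDirichletShift

/-- A direct sum of copies of a weighted shift multiplies norms on the kernel of its adjoint by
the modulus of the first weight. -/
theorem norm_apply_of_adjoint_eq_zero {E : Type*} [NormedAddCommGroup E]
    [InnerProductSpace ℂ E] [CompleteSpace E] {l : ℕ} {S : E →L[ℂ] E} {Sw : l2 ℕ →L[ℂ] l2 ℕ}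
    {w : ℕ → ℂ} (hw : ∀ n, w n ≠ 0) (hSw : ∀ n, Sw (evec n) = w n • evec (n + 1))
    (U : E ≃ₗᵢ[ℂ] PiLp 2 (fun _ : Fin l => l2 ℕ)) (hU : ∀ f, U (S f) = fun j => Sw (U f j))
    {f : E} (hf : adjoint S f = 0) : ‖S f‖ ^ 2 = ‖w 0‖ ^ 2 * ‖f‖ ^ 2 := by
  have hcoord : ∀ j n, (U f j) (n + 1) = 0 := by
    intro j n
    let g : E := U.symm (PiLp.single 2 j (evec n))
    have hg : U (S g) = PiLp.single 2 j (Sw (evec n)) := by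
      ext k : 1
      rw [hU]
      by_cases hk : k = j
      · subst hk
        simp [g]
      · simp [g, hk]
    have h : ⟪U (S g), U f⟫_ℂ = 0 := by
      rw [U.inner_map_map, ← adjoint_inner_right, hf, inner_zero_right]
    rw [hg, inner_piLp_single, hSw, inner_smul_left, inner_evec] at h
    exact (mul_eq_zero.1 h).resolve_left (by simpa using hw n)
  have hUf : ∀ j, U f j = (U f j) 0 • evec 0 := by
    intro j
    refine l2_ext fun n => ?_
    rw [lp.coeFn_smul, Pi.smul_apply, smul_eq_mul]
    cases n with
    | zero => rw [evec_apply_self, mul_one]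
    | succ n => rw [hcoord, evec_apply_ne n.succ_ne_zero, mul_zero]
  have hnorm : ∀ j, ‖Sw (U f j)‖ = ‖w 0‖ * ‖U f j‖ := by
    intro j
    rw [hUf j, map_smul, hSw]
    simp only [norm_smul, orthonormal_evec.1]
    ring
  rw [← U.norm_map (S f), ← U.norm_map f, PiLp.norm_sq_eq_of_L2, PiLp.norm_sq_eq_of_L2,
    Finset.mul_sum]
  refine Finset.sum_congr rfl fun j _ => ?_
  rw [hU, hnorm, mul_pow]

theorem stmt_13 {V : Type} [Countable V] [Infinite V] (T : DirTree V)
    (hL : T.Leafless) (hT : T.LocFin)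
    (hb : ∃ N : ℕ, ∀ v : V, 2 ≤ (T.chiFin hT v).card → T.depth v ≤ N)
    (q : ℕ) (hq : 1 ≤ q)
    (S : l2 V →L[ℂ] l2 V) (hS : T.IsDirichletShift hT (q : ℝ) S)
    (Sw : l2 ℕ →L[ℂ] l2 ℕ)
    (hSw : ∀ n : ℕ, Sw (evec n) =
      ((Real.sqrt (((n : ℝ) + q) / ((n : ℝ) + 1)) : ℝ) : ℂ) • evec (n + 1)) :
    (∃ l : ℕ, 0 < l ∧ ∃ U : l2 V ≃ₗᵢ[ℂ] PiLp 2 (fun _ : Fin l => l2 ℕ),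
        ∀ f : l2 V, U (S f) = fun j => Sw (U f j)) ↔
      (q = 1 ∨ ∀ v : V, (T.chiFin hT v).card ≤ 1) := by
  constructor
  · rintro ⟨l, -, U, hU⟩
    by_contra! hcon
    obtain ⟨hq1, v, hv⟩ := hcon
    have hq0 : (0 : ℝ) < q := by exact_mod_cast hq
    obtain ⟨u, hu, u', hu', hne⟩ := Finset.one_lt_card.1 hv
    rw [DirTree.mem_chiFin] at hu hu'
    have hnorm := norm_apply_of_adjoint_eq_zero
      (fun n => Complex.ofReal_ne_zero.2 (Real.sqrt_pos.2 (by positivity)).ne')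
      hSw U hU (hS.adjoint_sub_siblings hu hu')
    have hpos : (0 : ℝ) < ‖(evec u - evec u' : l2 V)‖ ^ 2 :=
      pow_pos (norm_pos_iff.2 (sub_ne_zero.2 (orthonormal_evec.linearIndependent.injective.ne hne)))
        2
    rw [hS.norm_sq_sub_siblings hq0 hL hu hu', mul_left_inj' hpos.ne', Complex.norm_real,
      Real.norm_eq_abs, sq_abs, Real.sq_sqrt (by positivity), Nat.cast_zero, zero_add, zero_add,
      div_one, div_eq_iff (by positivity)] at hnorm
    have hfac : ((T.depth v : ℝ) + 1) * ((q : ℝ) - 1) = 0 := by linear_combination -hnorm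
    rcases mul_eq_zero.1 hfac with h | h
    · exact absurd h (by positivity)
    · exact hq1 (by exact_mod_cast sub_eq_zero.1 h)
  · rintro (rfl | hcard)
    · rw [Nat.cast_one] at hS
      obtain ⟨l, hl, b, hbS⟩ := hS.exists_wold_basis hL hb
      refine ⟨l, hl, exists_unitary_of_hilbertBasis b hSw fun j n => ?_⟩
      rw [hbS, Nat.cast_one, div_self (by positivity), Real.sqrt_one, Complex.ofReal_one, one_smul]
    · obtain ⟨b, hbS⟩ := hS.exists_basis_of_card_le_one hL hcard
      exact ⟨1, one_pos, exists_unitary_of_hilbertBasis b hSw hbS⟩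

end
end

section
/- Let q be a positive integer and m ∈ ℕ. Then the sequence a_k = (m+1)_k/(m+q)_k (k ∈ ℕ) is a Hausdorff moment sequence: there exists a finite Borel measure μ on the interval [0,1] such that a_k = ∫_{[0,1]} t^k dμ(t) for every k ∈ ℕ. -/
open scoped ENNReal InnerProductSpace
open ContinuousLinearMap

noncomputable section

open scoped Nat in
/-- Pochhammer symbols at positive integers are quotients of factorials. -/
theorem poch_natCast_add_one (n k : ℕ) : poch ((n : ℝ) + 1) k = ((n + k)! : ℝ) / (n ! : ℝ) := by
  have hn : (n ! : ℝ) ≠ 0 := by positivity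
  induction k with
  | zero => simp [poch, hn]
  | succ k ih =>
    rw [poch, Finset.prod_range_succ, ← poch, ih, ← add_assoc, Nat.factorial_succ]
    push_cast
    ring

open scoped Nat in
/-- The beta integral at positive integers. -/
theorem integral_pow_mul_one_sub_pow (a p : ℕ) :
    ∫ t in (0 : ℝ)..1, t ^ a * (1 - t) ^ p = (a ! : ℝ) * (p ! : ℝ) / ((a + p + 1)! : ℝ) := by
  induction p generalizing a with
  | zero =>
    have ha : (a ! : ℝ) ≠ 0 := by positivity
    have ha' : (a : ℝ) + 1 ≠ 0 := by positivity
    simp only [pow_zero, mul_one, integral_pow, add_zero, Nat.factorial_succ, Nat.factorial_zero]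
    push_cast
    field_simp
    simp
  | succ p ih =>
    have hsplit : ∀ t : ℝ, t ^ a * (1 - t) ^ (p + 1) =
        t ^ a * (1 - t) ^ p - t ^ (a + 1) * (1 - t) ^ p := fun t => by ring
    simp only [hsplit]
    rw [intervalIntegral.integral_sub
      ((by fun_prop : Continuous fun t : ℝ => t ^ a * (1 - t) ^ p).intervalIntegrable _ _)
      ((by fun_prop : Continuous fun t : ℝ => t ^ (a + 1) * (1 - t) ^ p).intervalIntegrable _ _),
      ih, ih, show a + 1 + p + 1 = (a + p + 1) + 1 by ring,
      show a + (p + 1) + 1 = (a + p + 1) + 1 by ring,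
      Nat.factorial_succ (a + p + 1), Nat.factorial_succ a, Nat.factorial_succ p]
    have h : ((a + p + 1)! : ℝ) ≠ 0 := by positivity
    have h' : (a : ℝ) + p + 1 + 1 ≠ 0 := by positivity
    push_cast
    field_simp
    ring

theorem stmt_17 (q : ℕ) (hq : 1 ≤ q) (m : ℕ) :
    ∃ μ : MeasureTheory.Measure (Set.Icc (0 : ℝ) 1), MeasureTheory.IsFiniteMeasure μ ∧
      ∀ k : ℕ, poch ((m : ℝ) + 1) k / poch ((m : ℝ) + q) k = ∫ t, (t : ℝ) ^ k ∂μ := by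
  obtain rfl | ⟨p, rfl⟩ : q = 1 ∨ ∃ p, q = p + 2 := by
    rcases hq.eq_or_lt with h | h
    · exact .inl h.symm
    · exact .inr ⟨q - 2, by omega⟩
  · refine ⟨MeasureTheory.Measure.dirac 1, inferInstance, fun k => ?_⟩
    have h : poch ((m : ℝ) + 1) k ≠ 0 := by
      rw [poch_natCast_add_one]
      positivity
    simp [h]
  · set c : ℝ := ((m + p + 1).factorial : ℝ) / ((m.factorial : ℝ) * (p.factorial : ℝ)) with hc
    let f : Set.Icc (0 : ℝ) 1 → ℝ := fun t => c * ((t : ℝ) ^ m * (1 - (t : ℝ)) ^ p)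
    have hf : Continuous f := by fun_prop
    have hf0 : ∀ t, 0 ≤ f t := fun t =>
      mul_nonneg (by positivity)
        (mul_nonneg (pow_nonneg t.2.1 _) (pow_nonneg (sub_nonneg.2 t.2.2) _))
    have hfi : MeasureTheory.Integrable f :=
      hf.integrable_of_hasCompactSupport (HasCompactSupport.of_compactSpace f)
    refine ⟨MeasureTheory.volume.withDensity fun t => ENNReal.ofReal (f t),
      MeasureTheory.isFiniteMeasure_withDensity_ofReal hfi.2, fun k => ?_⟩
    rw [integral_withDensity_eq_integral_toReal_smul (by fun_prop) (by simp)]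
    have hg : ∀ t : Set.Icc (0 : ℝ) 1, (ENNReal.ofReal (f t)).toReal • (t : ℝ) ^ k =
        (fun s : ℝ => c * (s ^ (m + k) * (1 - s) ^ p)) t := fun t => by
      rw [ENNReal.toReal_ofReal (hf0 t), smul_eq_mul]
      simp only [f]
      ring
    simp only [hg]
    rw [MeasureTheory.integral_subtype measurableSet_Icc
        (fun s : ℝ => c * (s ^ (m + k) * (1 - s) ^ p)),
      MeasureTheory.integral_Icc_eq_integral_Ioc,
      ← intervalIntegral.integral_of_le zero_le_one, intervalIntegral.integral_const_mul,
      integral_pow_mul_one_sub_pow, poch_natCast_add_one,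
      show (m : ℝ) + ((p + 2 : ℕ) : ℝ) = ((m + p + 1 : ℕ) : ℝ) + 1 by push_cast; ring,
      poch_natCast_add_one, hc, show m + p + 1 + k = m + k + p + 1 by ring]
    field_simp

end
end

section
/- Let k and l be positive integers with l ≥ k, and for z, w in the open unit disc 𝔻 ⊆ ℂ define κ_{k,l}(z,w) = Σ_{n=0}^{∞} ((k)_n/(l)_n)·z^n·conj(w)^n. Then the series converges absolutely, κ_{k,l}(z,w) ≠ 0 for all z, w ∈ 𝔻, and the function F(z,w) = 1 − 1/κ_{k,l}(z,w) is a positive semidefinite kernel on 𝔻: for every m ∈ ℕ, all points z_1, …, z_m ∈ 𝔻 and all c_1, …, c_m ∈ ℂ, the sum Σ_{i,j=1}^{m} F(z_i, z_j)·c_j·conj(c_i) is a nonnegative real number. -/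
open scoped ENNReal InnerProductSpace
open ContinuousLinearMap

noncomputable section

/-- The kernel `κ_{k,l}(z,w) = Σ_n ((k)_n/(l)_n) zⁿ (conj w)ⁿ`. -/
def kappa (k l : ℕ) (z w : ℂ) : ℂ :=
  ∑' n : ℕ, ((poch (k : ℝ) n / poch (l : ℝ) n : ℝ) : ℂ) * z ^ n * (starRingEnd ℂ w) ^ n

open Finset in
/-- The coefficient recursion satisfied by the reciprocal of a power series with constant term 1. -/
theorem add_sum_coeff_inv_mk {a : ℕ → ℝ} (h0 : a 0 = 1) (n : ℕ) :
    a (n + 1) + ∑ j ∈ range (n + 1), (PowerSeries.mk a)⁻¹.coeff (j + 1) * a (n - j) = 0 := by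
  have h : (PowerSeries.mk a)⁻¹ * PowerSeries.mk a = 1 :=
    PowerSeries.inv_mul_cancel _ (by simp [← PowerSeries.coeff_zero_eq_constantCoeff_apply, h0])
  have h' := congrArg (PowerSeries.coeff (n + 1)) h
  rw [PowerSeries.coeff_mul, Nat.sum_antidiagonal_eq_sum_range_succ_mk, sum_range_succ'] at h'
  simpa [PowerSeries.coeff_one, h0, add_comm] using h'

open Finset in
/-- Kaluza's lemma: the reciprocal of a power series with positive coefficients of nondecreasing
ratio has nonpositive coefficients in positive degree. -/
theorem coeff_inv_mk_nonpos {a : ℕ → ℝ} (h0 : a 0 = 1) (hpos : ∀ n, 0 < a n)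
    (hmono : Monotone fun n => a (n + 1) / a n) (n : ℕ) :
    (PowerSeries.mk a)⁻¹.coeff (n + 1) ≤ 0 := by
  induction n using Nat.strong_induction_on with
  | _ n ih =>
    cases n with
    | zero =>
      have h := add_sum_coeff_inv_mk h0 0
      simp only [zero_add, range_one, sum_singleton, Nat.sub_self, h0, mul_one] at h
      linarith [hpos 1]
    | succ m =>
      have h₁ := add_sum_coeff_inv_mk h0 m
      have h₂ := add_sum_coeff_inv_mk h0 (m + 1)
      rw [sum_range_succ, Nat.sub_self, h0, mul_one] at h₂
      have hle : a (m + 2) / a (m + 1) *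
            ∑ j ∈ range (m + 1), (PowerSeries.mk a)⁻¹.coeff (j + 1) * a (m - j) ≤
          ∑ j ∈ range (m + 1), (PowerSeries.mk a)⁻¹.coeff (j + 1) * a (m + 1 - j) := by
        rw [mul_sum]
        refine sum_le_sum fun j hj => ?_
        have hj' := mem_range.1 hj
        have hr : a (m - j + 1) / a (m - j) ≤ a (m + 2) / a (m + 1) :=
          hmono (show m - j ≤ m + 1 by omega)
        rw [div_le_iff₀ (hpos _)] at hr
        rw [show m + 1 - j = m - j + 1 by omega]
        linarith [mul_le_mul_of_nonpos_left hr (ih j hj')]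
      rw [eq_neg_of_add_eq_zero_right h₁, mul_neg, div_mul_cancel₀ _ (hpos _).ne'] at hle
      linarith

open Finset in
/-- The coefficients of the reciprocal are dominated by those of the series. -/
theorem abs_coeff_inv_mk_le {a : ℕ → ℝ} (h0 : a 0 = 1) (hpos : ∀ n, 0 < a n)
    (hmono : Monotone fun n => a (n + 1) / a n) (n : ℕ) :
    |(PowerSeries.mk a)⁻¹.coeff n| ≤ a n := by
  cases n with
  | zero => simp [h0]
  | succ n =>
    have h := add_sum_coeff_inv_mk h0 n
    rw [sum_range_succ, Nat.sub_self, h0, mul_one] at h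
    rw [abs_of_nonpos (coeff_inv_mk_nonpos h0 hpos hmono n)]
    have : ∑ j ∈ range n, (PowerSeries.mk a)⁻¹.coeff (j + 1) * a (n - j) ≤ 0 :=
      sum_nonpos fun j _ =>
        mul_nonpos_of_nonpos_of_nonneg (coeff_inv_mk_nonpos h0 hpos hmono j) (hpos _).le
    linarith

theorem summable_norm_ofReal_mul_pow {a : ℕ → ℝ} (ha : ∀ n, |a n| ≤ 1) {x : ℂ} (hx : ‖x‖ < 1) :
    Summable fun n : ℕ => ‖(a n : ℂ) * x ^ n‖ := by
  refine (summable_geometric_of_lt_one (norm_nonneg x) hx).of_nonneg_of_le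
    (fun n => norm_nonneg _) fun n => ?_
  rw [norm_mul, norm_pow, Complex.norm_real, Real.norm_eq_abs]
  exact mul_le_of_le_one_left (by positivity) (ha n)

open Finset in
/-- The formal reciprocal is the pointwise reciprocal, given absolute convergence. -/
theorem tsum_mul_tsum_coeff_inv_mk {a : ℕ → ℝ} (h0 : a 0 = 1) {x : ℂ}
    (ha : Summable fun n : ℕ => ‖(a n : ℂ) * x ^ n‖)
    (hinv : Summable fun n : ℕ => ‖((PowerSeries.mk a)⁻¹.coeff n : ℂ) * x ^ n‖) :
    (∑' n : ℕ, (a n : ℂ) * x ^ n) *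
      ∑' n : ℕ, ((PowerSeries.mk a)⁻¹.coeff n : ℂ) * x ^ n = 1 := by
  have h : PowerSeries.mk a * (PowerSeries.mk a)⁻¹ = 1 :=
    PowerSeries.mul_inv_cancel _ (by simp [← PowerSeries.coeff_zero_eq_constantCoeff_apply, h0])
  rw [tsum_mul_tsum_eq_tsum_sum_antidiagonal_of_summable_norm ha hinv, tsum_eq_single 0]
  · simp [h0]
  · intro n hn
    have h' := congrArg (PowerSeries.coeff n) h
    rw [PowerSeries.coeff_mul, PowerSeries.coeff_one, if_neg hn] at h'
    simp only [PowerSeries.coeff_mk] at h'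
    calc _ = ((∑ p ∈ antidiagonal n, a p.1 * (PowerSeries.mk a)⁻¹.coeff p.2 : ℝ) : ℂ) * x ^ n := by
          push_cast
          rw [sum_mul]
          refine sum_congr rfl fun p hp => ?_
          rw [← mem_antidiagonal.1 hp, pow_add]
          ring
      _ = 0 := by rw [h']; simp

/-- A power series in `z * conj w` with nonnegative coefficients is a positive semidefinite
kernel. -/
theorem sum_sum_kernel_nonneg {b : ℕ → ℝ} (hb : ∀ n, 0 ≤ b n) {K : ℂ → ℂ → ℂ} {ι : Type*}
    [Fintype ι] (zs c : ι → ℂ)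
    (hK : ∀ i j, HasSum (fun n : ℕ => (b n : ℂ) * (zs i * starRingEnd ℂ (zs j)) ^ n)
      (K (zs i) (zs j))) :
    0 ≤ (∑ i, ∑ j, K (zs i) (zs j) * c j * starRingEnd ℂ (c i)).re ∧
      (∑ i, ∑ j, K (zs i) (zs j) * c j * starRingEnd ℂ (c i)).im = 0 := by
  have hsum : HasSum
      (fun n : ℕ => ((b n * Complex.normSq (∑ i, zs i ^ n * starRingEnd ℂ (c i)) : ℝ) : ℂ))
      (∑ i, ∑ j, K (zs i) (zs j) * c j * starRingEnd ℂ (c i)) := by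
    have h := hasSum_sum (s := Finset.univ) fun i _ => hasSum_sum (s := Finset.univ) fun j _ =>
      ((hK i j).mul_right (c j)).mul_right (starRingEnd ℂ (c i))
    refine h.congr_fun fun n => ?_
    rw [Complex.ofReal_mul, ← Complex.mul_conj, map_sum, Finset.sum_mul_sum, Finset.mul_sum]
    refine Finset.sum_congr rfl fun i _ => ?_
    rw [Finset.mul_sum]
    refine Finset.sum_congr rfl fun j _ => ?_
    simp only [map_mul, map_pow, Complex.conj_conj, mul_pow]
    ring
  have hre := Complex.hasSum_re hsum
  have him := Complex.hasSum_im hsum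
  simp only [Complex.ofReal_re, Complex.ofReal_im] at hre him
  exact ⟨hre.nonneg fun n => mul_nonneg (hb n) (Complex.normSq_nonneg _),
    him.unique hasSum_zero⟩

theorem poch_pos {x : ℝ} (hx : 0 < x) (n : ℕ) : 0 < poch x n :=
  Finset.prod_pos fun _ _ => by positivity

theorem poch_le_poch {x y : ℝ} (hx : 0 ≤ x) (hxy : x ≤ y) (n : ℕ) : poch x n ≤ poch y n :=
  Finset.prod_le_prod (fun _ _ => by positivity) fun _ _ => by linarith

theorem monotone_poch_div_poch_ratio {x y : ℝ} (hx : 0 < x) (hxy : x ≤ y) :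
    Monotone fun n : ℕ => poch x (n + 1) / poch y (n + 1) / (poch x n / poch y n) := by
  have hy := hx.trans_le hxy
  have h : ∀ n : ℕ, poch x (n + 1) / poch y (n + 1) / (poch x n / poch y n) =
      (x + n) / (y + n) := fun n => by
    have h₁ := (poch_pos hx n).ne'
    have h₂ := (poch_pos hy n).ne'
    have h₃ : y + n ≠ 0 := by positivity
    simp only [poch, Finset.prod_range_succ] at h₁ h₂ ⊢
    field_simp
  intro n m hnm
  simp only [h]
  rw [div_le_div_iff₀ (by positivity) (by positivity)]
  have : (n : ℝ) ≤ m := by exact_mod_cast hnm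
  nlinarith

theorem norm_mul_conj_lt_one {z w : ℂ} (hz : ‖z‖ < 1) (hw : ‖w‖ < 1) :
    ‖z * starRingEnd ℂ w‖ < 1 := by
  rw [norm_mul, RCLike.norm_conj]
  exact mul_lt_one_of_nonneg_of_lt_one_left (norm_nonneg _) hz hw.le

theorem stmt_18 (k l : ℕ) (hk : 1 ≤ k) (hkl : k ≤ l) :
    (∀ z w : ℂ, ‖z‖ < 1 → ‖w‖ < 1 →
      Summable fun n : ℕ =>
        ‖((poch (k : ℝ) n / poch (l : ℝ) n : ℝ) : ℂ) * z ^ n * (starRingEnd ℂ w) ^ n‖) ∧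
    (∀ z w : ℂ, ‖z‖ < 1 → ‖w‖ < 1 → kappa k l z w ≠ 0) ∧
    ∀ (m : ℕ) (zs : Fin m → ℂ), (∀ i, ‖zs i‖ < 1) → ∀ c : Fin m → ℂ,
      0 ≤ (∑ i, ∑ j, (1 - (kappa k l (zs i) (zs j))⁻¹) * c j * (starRingEnd ℂ) (c i)).re ∧
      (∑ i, ∑ j, (1 - (kappa k l (zs i) (zs j))⁻¹) * c j * (starRingEnd ℂ) (c i)).im = 0 := by
  set a : ℕ → ℝ := fun n => poch k n / poch l n with ha
  have hk0 : (0 : ℝ) < k := by exact_mod_cast hk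
  have hkl' : (k : ℝ) ≤ l := by exact_mod_cast hkl
  have h0 : a 0 = 1 := by simp [ha, poch]
  have hpos : ∀ n, 0 < a n := fun n => div_pos (poch_pos hk0 n) (poch_pos (hk0.trans_le hkl') n)
  have hle : ∀ n, a n ≤ 1 := fun n =>
    div_le_one_of_le₀ (poch_le_poch hk0.le hkl' n) (poch_pos (hk0.trans_le hkl') n).le
  have hmono : Monotone fun n => a (n + 1) / a n := monotone_poch_div_poch_ratio hk0 hkl'
  set e : ℕ → ℝ := fun n => (PowerSeries.mk a)⁻¹.coeff n with he
  have hsa : ∀ {x : ℂ}, ‖x‖ < 1 → Summable fun n : ℕ => ‖(a n : ℂ) * x ^ n‖ :=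
    summable_norm_ofReal_mul_pow fun n => (abs_of_pos (hpos n)).trans_le (hle n)
  have hse : ∀ {x : ℂ}, ‖x‖ < 1 → Summable fun n : ℕ => ‖(e n : ℂ) * x ^ n‖ :=
    summable_norm_ofReal_mul_pow fun n => (abs_coeff_inv_mk_le h0 hpos hmono n).trans (hle n)
  have hkappa : ∀ z w : ℂ, kappa k l z w = ∑' n : ℕ, (a n : ℂ) * (z * starRingEnd ℂ w) ^ n :=
    fun z w => tsum_congr fun n => by rw [mul_pow, mul_assoc]
  have hmul : ∀ z w : ℂ, ‖z‖ < 1 → ‖w‖ < 1 →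
      kappa k l z w * ∑' n : ℕ, (e n : ℂ) * (z * starRingEnd ℂ w) ^ n = 1 := fun z w hz hw => by
    have hx := norm_mul_conj_lt_one hz hw
    rw [hkappa]
    exact tsum_mul_tsum_coeff_inv_mk h0 (hsa hx) (hse hx)
  refine ⟨fun z w hz hw => ?_, fun z w hz hw => left_ne_zero_of_mul_eq_one (hmul z w hz hw),
    fun m zs hzs c => ?_⟩
  · simpa only [mul_pow, mul_assoc] using hsa (norm_mul_conj_lt_one hz hw)
  · refine sum_sum_kernel_nonneg (b := fun n => if n = 0 then 0 else -e n)
      (K := fun z w => 1 - (kappa k l z w)⁻¹) (fun n => ?_) zs c fun i j => ?_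
    · cases n with
      | zero => simp
      | succ n => simpa using coeff_inv_mk_nonpos h0 hpos hmono n
    · rw [inv_eq_of_mul_eq_one_right (hmul _ _ (hzs i) (hzs j))]
      have h := (hasSum_ite_eq (0 : ℕ) (1 : ℂ)).sub
        (hse (norm_mul_conj_lt_one (hzs i) (hzs j))).of_norm.hasSum
      refine h.congr_fun fun n => ?_
      cases n with
      | zero => simp [he, h0]
      | succ n => simp

end
end
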